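/- Let X be a real Hilbert space with inner product ⟨·,·⟩_X and norm ‖·‖_X, and let (⟨·,·⟩_u)_{u ∈ X\{0}} be a family of inner products on X satisfying: (M1) for every u ≠ 0 there are a neighborhood U ⊂ X \ {0} of u and C > 0 with C⁻¹‖v‖_X ≤ ‖v‖_{ũ} ≤ C‖v‖_X for all ũ ∈ U and v ∈ X; (M4) for every u ≠ 0 there are a neighborhood U and C > 0 with |⟨v,w⟩_{u₁} − ⟨v,w⟩_{u₂}| ≤ C‖u₁−u₂‖_X ‖v‖_X ‖w‖_X for all u₁,u₂ ∈ U and v,w ∈ X. Let M ⊂ X \ {0} and let each u ∈ M be assigned a closed subspace T_u ⊂ X such that the map u ↦ Π_u, where Π_u is the ⟨·,·⟩_X-orthogonal projection onto T_u, is locally Lipschitz from M to bounded operators in operator norm. For u ∈ M let P_u denote the ⟨·,·⟩_u-orthogonal projection of X onto T_u. Then for every u ∈ M there exist a neighborhood U ⊂ M of u and a constant C > 0 such that ‖P_{u₁} − P_{u₂}‖_{L(X)} ≤ C ‖u₁ − u₂‖_X for all u₁, u₂ ∈ U. -/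

import Mathlib

open scoped RealInnerProductSpace

theorem exists_bilinForm_of_symm {X : Type*} [AddCommGroup X] [Module ℝ X]
    (f : X → X → ℝ) (hsymm : ∀ v w, f v w = f w v)
    (hadd : ∀ v₁ v₂ w, f (v₁ + v₂) w = f v₁ w + f v₂ w)
    (hsmul : ∀ (c : ℝ) v w, f (c • v) w = c * f v w) :
    ∃ B : LinearMap.BilinForm ℝ X, ∀ v w, B v w = f v w :=
  ⟨LinearMap.mk₂ ℝ f hadd hsmul
    (fun v w₁ w₂ => by rw [hsymm, hadd, hsymm w₁, hsymm w₂])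
    (fun c v w => by rw [hsymm, hsmul, hsymm w, smul_eq_mul]), fun _ _ => rfl⟩

theorem abs_bilinForm_le_of_apply_self_le {X : Type*} [NormedAddCommGroup X] [NormedSpace ℝ X]
    (B : LinearMap.BilinForm ℝ X) (hsymm : ∀ v w, B v w = B w v) (hnonneg : ∀ v, 0 ≤ B v v)
    {b : ℝ} (hb : 0 ≤ b) (hle : ∀ v, B v v ≤ b * ‖v‖ ^ 2) (v w : X) :
    |B v w| ≤ b * ‖v‖ * ‖w‖ := by
  apply abs_le_of_sq_le_sq _ (by positivity)
  calc B v w ^ 2 ≤ B v v * B w w :=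
      LinearMap.BilinForm.apply_sq_le_of_symm B hnonneg ⟨hsymm⟩ v w
    _ ≤ (b * ‖v‖ ^ 2) * (b * ‖w‖ ^ 2) :=
      mul_le_mul (hle v) (hle w) (hnonneg w) (by positivity)
    _ = (b * ‖v‖ * ‖w‖) ^ 2 := by ring

theorem norm_le_of_mul_sq_le {X : Type*} [NormedAddCommGroup X] {a K : ℝ} (ha : 0 < a)
    (hK : 0 ≤ K) {z : X} (h : a * ‖z‖ ^ 2 ≤ K * ‖z‖) : ‖z‖ ≤ K / a := by
  rcases (norm_nonneg z).eq_or_lt with hz | hz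
  · rw [← hz]; positivity
  · rw [le_div_iff₀ ha]
    exact le_of_mul_le_mul_right (by linarith) hz

/-- Quantitative perturbation bound for the orthogonal projections `P₁`, `P₂` with respect to two
bilinear forms `B₁`, `B₂`; here `Q₁`, `Q₂` are any bounded projections onto the same subspaces. -/
theorem norm_projection_sub_le {X : Type*} [NormedAddCommGroup X] [NormedSpace ℝ X]
    (B₁ B₂ : LinearMap.BilinForm ℝ X) {a b δ η : ℝ} (ha : 0 < a) (hb : 0 ≤ b)
    (hδ : 0 ≤ δ) (hη : 0 ≤ η)
    (hcoer₁ : ∀ v, a * ‖v‖ ^ 2 ≤ B₁ v v) (hcoer₂ : ∀ v, a * ‖v‖ ^ 2 ≤ B₂ v v)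
    (hbound₁ : ∀ v w, |B₁ v w| ≤ b * ‖v‖ * ‖w‖) (hbound₂ : ∀ v w, |B₂ v w| ≤ b * ‖v‖ * ‖w‖)
    (hsub : ∀ v w, |B₁ v w - B₂ v w| ≤ δ * ‖v‖ * ‖w‖)
    (T₁ T₂ : Submodule ℝ X) (Q₁ Q₂ P₁ P₂ : X →L[ℝ] X)
    (hQ₁ : ∀ v, Q₁ v ∈ T₁) (hQ₁' : ∀ v ∈ T₁, Q₁ v = v)
    (hQ₂ : ∀ v, Q₂ v ∈ T₂) (hQ₂' : ∀ v ∈ T₂, Q₂ v = v) (hQ : ‖Q₁ - Q₂‖ ≤ η)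
    (hP₁ : ∀ v, P₁ v ∈ T₁) (hP₁' : ∀ v, ∀ w ∈ T₁, B₁ (v - P₁ v) w = 0)
    (hP₂ : ∀ v, P₂ v ∈ T₂) (hP₂' : ∀ v, ∀ w ∈ T₂, B₂ (v - P₂ v) w = 0) :
    ‖P₁ - P₂‖ ≤
      ((δ + b * η) * (1 + b / a) + b * η * (b / a)) / a + η * (b / a) := by
  refine ContinuousLinearMap.opNorm_le_bound _ (by positivity) fun v => ?_
  have hQv : ∀ x, ‖Q₁ x - Q₂ x‖ ≤ η * ‖x‖ := fun x =>
    (ContinuousLinearMap.le_opNorm (Q₁ - Q₂) x).trans (by gcongr)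
  set x := P₁ v with hx
  set y := P₂ v with hy
  have hyT : y ∈ T₂ := hP₂ v
  have hynorm : ‖y‖ ≤ b / a * ‖v‖ := by
    have h0 : B₂ (v - y) y = 0 := hP₂' v y hyT
    rw [map_sub, LinearMap.sub_apply, sub_eq_zero] at h0
    have := norm_le_of_mul_sq_le ha (by positivity)
      ((hcoer₂ y).trans (h0 ▸ (le_abs_self _).trans (hbound₂ v y)))
    rwa [div_mul_eq_mul_div]
  have hvy : ‖v - y‖ ≤ (1 + b / a) * ‖v‖ := by
    linarith [norm_sub_le v y]
  have hyQ : ‖y - Q₁ y‖ ≤ η * (b / a) * ‖v‖ := by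
    have h1 := hQv y
    rw [hQ₂' y hyT, norm_sub_rev] at h1
    calc _ ≤ η * ‖y‖ := h1
      _ ≤ η * (b / a * ‖v‖) := by gcongr
      _ = _ := by ring
  obtain ⟨z, hz⟩ : ∃ z, z = x - Q₁ y := ⟨_, rfl⟩
  have hzT : z ∈ T₁ := hz ▸ T₁.sub_mem (hP₁ v) (hQ₁ y)
  have hzQ : ‖z - Q₂ z‖ ≤ η * ‖z‖ := by
    have h1 := hQv z
    rwa [hQ₁' z hzT] at h1
  have hdecomp : B₁ z z = (B₁ (v - y) z - B₂ (v - y) z) + B₂ (v - y) (z - Q₂ z)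
      + B₁ (y - Q₁ y) z := by
    have h1 : B₁ (v - x) z = 0 := hP₁' v z hzT
    have h2 : B₂ (v - y) (Q₂ z) = 0 := hP₂' v _ (hQ₂ z)
    have h3 : z = (v - y) + (y - Q₁ y) - (v - x) := by rw [hz]; abel
    have h4 : B₁ z z = B₁ (v - y) z + B₁ (y - Q₁ y) z - B₁ (v - x) z := by
      conv_lhs => enter [1]; rw [h3]
      rw [map_sub, map_add, LinearMap.sub_apply, LinearMap.add_apply]
    rw [h4, h1, map_sub (B₂ (v - y)), h2]
    ring
  have hznorm : ‖z‖ ≤ ((δ + b * η) * (1 + b / a) + b * η * (b / a)) * ‖v‖ / a := by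
    refine norm_le_of_mul_sq_le ha (by positivity) ((hcoer₁ z).trans ?_)
    have e1 : B₁ (v - y) z - B₂ (v - y) z ≤ δ * ((1 + b / a) * ‖v‖) * ‖z‖ :=
      (le_abs_self _).trans ((hsub _ _).trans (by gcongr))
    have e2 : B₂ (v - y) (z - Q₂ z) ≤ b * ((1 + b / a) * ‖v‖) * (η * ‖z‖) :=
      (le_abs_self _).trans ((hbound₂ _ _).trans (by gcongr))
    have e3 : B₁ (y - Q₁ y) z ≤ b * (η * (b / a) * ‖v‖) * ‖z‖ :=
      (le_abs_self _).trans ((hbound₁ _ _).trans (by gcongr))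
    rw [hdecomp]
    linarith
  have hxy : (P₁ - P₂) v = z - (y - Q₁ y) := by
    rw [sub_apply, ← hx, ← hy, hz]; abel
  rw [hxy]
  calc ‖z - (y - Q₁ y)‖ ≤ ‖z‖ + ‖y - Q₁ y‖ := norm_sub_le _ _
    _ ≤ _ := add_le_add hznorm hyQ
    _ = _ := by ring

/-- Let `X` be a real Hilbert space with a family of inner products
`ip u = ⟨·,·⟩_u` (for `u ≠ 0`) satisfying the locally uniform equivalence (M1) and the
local Lipschitz estimate (M4). Let `M ⊆ X \ {0}`, let `T u` be closed subspaces assigned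
to points of `M` such that the `⟨·,·⟩_X`-orthogonal projections `Π_u` onto `T u` depend
locally Lipschitz-continuously on `u`, and let `P u` be the `⟨·,·⟩_u`-orthogonal
projection onto `T u`. Then `u ↦ P u` is locally Lipschitz in the operator norm. -/
theorem u_dependent_projection_locally_lipschitz
    {X : Type*} [NormedAddCommGroup X] [InnerProductSpace ℝ X] [CompleteSpace X]
    (ip : X → X → X → ℝ)
    -- `ip u` is an inner product for every `u ≠ 0`:
    (ip_symm : ∀ u : X, u ≠ 0 → ∀ v w : X, ip u v w = ip u w v)
    (ip_add : ∀ u : X, u ≠ 0 → ∀ v₁ v₂ w : X, ip u (v₁ + v₂) w = ip u v₁ w + ip u v₂ w)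
    (ip_smul : ∀ u : X, u ≠ 0 → ∀ (c : ℝ) (v w : X), ip u (c • v) w = c * ip u v w)
    (ip_pos : ∀ u : X, u ≠ 0 → ∀ v : X, v ≠ 0 → 0 < ip u v v)
    -- (M1) locally uniform equivalence of the norms `‖·‖_u` with `‖·‖_X`:
    (hM1 : ∀ u : X, u ≠ 0 → ∃ (U : Set X) (C : ℝ), 0 < C ∧ IsOpen U ∧ u ∈ U ∧
      (0:X) ∉ U ∧ ∀ u' ∈ U, ∀ v : X,
        C⁻¹ * ‖v‖ ≤ Real.sqrt (ip u' v v) ∧ Real.sqrt (ip u' v v) ≤ C * ‖v‖)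
    -- (M4) local Lipschitz dependence of the scalar products on the base point:
    (hM4 : ∀ u : X, u ≠ 0 → ∃ (U : Set X) (C : ℝ), 0 < C ∧ IsOpen U ∧ u ∈ U ∧
      (0:X) ∉ U ∧ ∀ u₁ ∈ U, ∀ u₂ ∈ U, ∀ v w : X,
        |ip u₁ v w - ip u₂ v w| ≤ C * ‖u₁ - u₂‖ * ‖v‖ * ‖w‖)
    (M : Set X) (hM0 : (0:X) ∉ M)
    (T : X → Submodule ℝ X) (hTclosed : ∀ u ∈ M, IsClosed (T u : Set X))
    -- `Π u` is the `⟨·,·⟩_X`-orthogonal projection onto `T u`: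
    (Pi : X → X →L[ℝ] X)
    (hPi : ∀ u ∈ M, (∀ v : X, Pi u v ∈ T u) ∧ (∀ v ∈ T u, Pi u v = v) ∧
      ∀ v : X, ∀ w ∈ T u, ⟪v - Pi u v, w⟫ = 0)
    -- `u ↦ Π u` is locally Lipschitz in the operator norm:
    (hPiLip : ∀ u ∈ M, ∃ (ε C : ℝ), 0 < ε ∧ 0 < C ∧ ∀ u₁ ∈ M, ∀ u₂ ∈ M,
      ‖u₁ - u‖ < ε → ‖u₂ - u‖ < ε → ‖Pi u₁ - Pi u₂‖ ≤ C * ‖u₁ - u₂‖)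
    -- `P u` is the `⟨·,·⟩_u`-orthogonal projection onto `T u`:
    (P : X → X →L[ℝ] X)
    (hP : ∀ u ∈ M, (∀ v : X, P u v ∈ T u) ∧ (∀ v ∈ T u, P u v = v) ∧
      ∀ v : X, ∀ w ∈ T u, ip u (v - P u v) w = 0) :
    ∀ u ∈ M, ∃ (ε C : ℝ), 0 < ε ∧ 0 < C ∧ ∀ u₁ ∈ M, ∀ u₂ ∈ M,
      ‖u₁ - u‖ < ε → ‖u₂ - u‖ < ε → ‖P u₁ - P u₂‖ ≤ C * ‖u₁ - u₂‖ := by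
  intro u hu
  have hu0 : u ≠ 0 := ne_of_mem_of_not_mem hu hM0
  obtain ⟨U, C, hC, hU, huU, hU0, hUC⟩ := hM1 u hu0
  obtain ⟨V, D, hD, hV, huV, -, hVD⟩ := hM4 u hu0
  obtain ⟨r, L, hr, hL, hrL⟩ := hPiLip u hu
  obtain ⟨s, hs, hsUV⟩ := Metric.isOpen_iff.mp (hU.inter hV) u ⟨huU, huV⟩
  have key : ∀ u' ∈ U, ∃ B : LinearMap.BilinForm ℝ X, (∀ v w, B v w = ip u' v w) ∧
      (∀ v, (C ^ 2)⁻¹ * ‖v‖ ^ 2 ≤ B v v) ∧ ∀ v w, |B v w| ≤ C ^ 2 * ‖v‖ * ‖w‖ := by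
    intro u' hu'
    have h0 : u' ≠ 0 := ne_of_mem_of_not_mem hu' hU0
    obtain ⟨B, hB⟩ := exists_bilinForm_of_symm (ip u') (ip_symm u' h0) (ip_add u' h0)
      (ip_smul u' h0)
    have hnonneg : ∀ v, 0 ≤ B v v := by
      intro v
      rcases eq_or_ne v 0 with rfl | hv
      · simp
      · rw [hB]; exact (ip_pos u' h0 v hv).le
    have hsq : ∀ v, √(ip u' v v) ^ 2 = B v v := fun v => by
      rw [← hB, Real.sq_sqrt (hnonneg v)]
    refine ⟨B, hB, fun v => ?_, abs_bilinForm_le_of_apply_self_le B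
      (fun v w => by rw [hB, hB, ip_symm u' h0]) hnonneg (by positivity) fun v => ?_⟩
    · rw [← hsq, ← inv_pow, ← mul_pow]
      exact pow_le_pow_left₀ (by positivity) (hUC u' hu' v).1 2
    · rw [← hsq, ← mul_pow]
      exact pow_le_pow_left₀ (Real.sqrt_nonneg _) (hUC u' hu' v).2 2
  set a := (C ^ 2)⁻¹ with ha
  set b := C ^ 2 with hb
  have ha0 : 0 < a := by positivity
  have hb0 : 0 < b := by positivity
  refine ⟨min r s, ((D + b * L) * (1 + b / a) + b * L * (b / a)) / a + L * (b / a),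
    lt_min hr hs, by positivity, fun u₁ hu₁ u₂ hu₂ h₁ h₂ => ?_⟩
  have hm₁ := hsUV (mem_ball_iff_norm.mpr (h₁.trans_le (min_le_right _ _)))
  have hm₂ := hsUV (mem_ball_iff_norm.mpr (h₂.trans_le (min_le_right _ _)))
  obtain ⟨B₁, hB₁, hcoer₁, hbound₁⟩ := key u₁ hm₁.1
  obtain ⟨B₂, hB₂, hcoer₂, hbound₂⟩ := key u₂ hm₂.1
  refine (norm_projection_sub_le B₁ B₂ (δ := D * ‖u₁ - u₂‖) (η := L * ‖u₁ - u₂‖) ha0 hb0.le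
    (by positivity) (by positivity) hcoer₁ hcoer₂ hbound₁ hbound₂
    (fun v w => by rw [hB₁, hB₂]; exact hVD u₁ hm₁.2 u₂ hm₂.2 v w) (T u₁) (T u₂) (Pi u₁) (Pi u₂)
    (P u₁) (P u₂) (hPi u₁ hu₁).1 (hPi u₁ hu₁).2.1 (hPi u₂ hu₂).1 (hPi u₂ hu₂).2.1
    (hrL u₁ hu₁ u₂ hu₂ (h₁.trans_le (min_le_left _ _)) (h₂.trans_le (min_le_left _ _)))
    (hP u₁ hu₁).1 (fun v w hw => by rw [hB₁]; exact (hP u₁ hu₁).2.2 v w hw)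
    (hP u₂ hu₂).1 (fun v w hw => by rw [hB₂]; exact (hP u₂ hu₂).2.2 v w hw)).trans_eq ?_
  ring
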